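/- arXiv:1301.3335 — 2 statements merged into one kernel-verified Lean document; each statement's English description precedes it below -/
import Mathlib

section
/- (Minimizers are concentrated on minimizing extremals, Theorem 3.4(i).) Let μ_a, μ_b be Borel probability measures on ℝⁿ with compact support that are absolutely continuous with respect to Lebesgue measure, and let K_a = supp μ_a, K_b = supp μ_b denote their topological supports. If π ∈ 𝒫(C([a,b];ℝⁿ)) is a minimizer of 𝔸_{μ_a,μ_b} (i.e. 𝔸_{μ_a,μ_b}(π) ≤ 𝔸_{μ_a,μ_b}(π') for all π') with 𝔸_{μ_a,μ_b}(π) < ∞, then π(Γ^min_{K_a,K_b}) = 1, i.e. π is concentrated on the set of minimizing extremals from K_a to K_b. -/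
open MeasureTheory Filter Topology
open scoped ENNReal NNReal

noncomputable section

/-- Euclidean space `ℝⁿ`. -/
abbrev Eu (n : ℕ) := EuclideanSpace ℝ (Fin n)

/-- The space `C([a,b];ℝⁿ)` of continuous curves with the supremum metric. -/
abbrev CPath (a b : ℝ) (n : ℕ) := C(Set.Icc a b, Eu n)

/-- We endow the path space with its Borel σ-algebra. -/
noncomputable instance pathMeasurableSpace (a b : ℝ) (n : ℕ) :
    MeasurableSpace (CPath a b n) := borel _

instance pathBorelSpace (a b : ℝ) (n : ℕ) : BorelSpace (CPath a b n) :=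
  ⟨rfl⟩

/-- Evaluation of a curve at time `t ∈ [a,b]` (junk value `0` outside `[a,b]`). -/
def pev {a b : ℝ} {n : ℕ} (γ : CPath a b n) (t : ℝ) : Eu n :=
  if ht : t ∈ Set.Icc a b then γ ⟨t, ht⟩ else 0

/-- A curve is absolutely continuous if it has a Bochner-integrable derivative `g` with
`γ t = γ s + ∫_s^t g`. -/
def IsACC {a b : ℝ} {n : ℕ} (γ : CPath a b n) : Prop :=
  ∃ g : ℝ → Eu n, IntegrableOn g (Set.Icc a b) ∧
    ∀ s t : Set.Icc a b, γ t = γ s + ∫ u in (s : ℝ)..(t : ℝ), g u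

open Classical in
/-- The action `𝒜(γ) = ∫_a^b L(γ(t), γ̇(t)) dt ∈ (−∞,+∞]`, equal to `+∞` on curves that are
not absolutely continuous (and, by the convention that the integral is `+∞` when the
integrand fails to be integrable -- its negative part being automatically integrable --
also on absolutely continuous curves with non-integrable Lagrangian). -/
def action {n : ℕ} (L : Eu n → Eu n → ℝ) (a b : ℝ) (γ : CPath a b n) : EReal :=
  if h : IsACC γ then
    (if IntegrableOn (fun t => L (pev γ t) (h.choose t)) (Set.Icc a b) then
      (((∫ t in Set.Icc a b, L (pev γ t) (h.choose t)) : ℝ) : EReal)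
    else ⊤)
  else ⊤

/-- Positive part of an extended real, as `ℝ≥0∞`. -/
def epos (x : EReal) : ℝ≥0∞ := if x = ⊤ then ⊤ else ENNReal.ofReal x.toReal

/-- The integral `∫ F dπ ∈ [−∞,+∞]` of an extended-real-valued function, defined as the
difference of the lower integrals of the positive and negative parts. -/
def mint {X : Type*} [MeasurableSpace X] (F : X → EReal) (π : Measure X) : EReal :=
  ((∫⁻ γ, epos (F γ) ∂π : ℝ≥0∞) : EReal) - ((∫⁻ γ, epos (-(F γ)) ∂π : ℝ≥0∞) : EReal)

open Classical in
/-- The constrained functional `𝔸_{μa,μb}(π) = ∫ 𝒜 dπ` if `pr_a#π = μa` and `pr_b#π = μb`,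
and `+∞` otherwise, for a given (extended-real-valued) action functional `F`. -/
def aFun {a b : ℝ} {n : ℕ} (F : CPath a b n → EReal) (μa μb : Measure (Eu n))
    (π : Measure (CPath a b n)) : EReal :=
  if Measure.map (fun γ => pev γ a) π = μa ∧ Measure.map (fun γ => pev γ b) π = μb then
    mint F π
  else ⊤

/-- Weak convergence of a sequence of measures: convergence of the integrals of all bounded
continuous functions. -/
def WeakLim {X : Type*} [TopologicalSpace X] [MeasurableSpace X]
    (πs : ℕ → Measure X) (π : Measure X) : Prop :=
  ∀ φ : BoundedContinuousFunction X ℝ,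
    Tendsto (fun N => ∫ x, φ x ∂(πs N)) atTop (𝓝 (∫ x, φ x ∂π))

/-- The empirical measure `(1/N) ∑_{i=1}^N δ_{x i}`. -/
def emp {X : Type*} [MeasurableSpace X] (N : ℕ) (x : Fin N → X) : Measure X :=
  (N : ℝ≥0∞)⁻¹ • ∑ i : Fin N, Measure.dirac (x i)

/-- The topological support of a measure. -/
def msupp {α : Type*} [TopologicalSpace α] [MeasurableSpace α] (μ : Measure α) : Set α :=
  {x | ∀ U : Set α, IsOpen U → x ∈ U → 0 < μ U}

/-- The set `Γ^min_{K₁,K₂}` of minimizing extremals starting in `K₁` and ending in `K₂`. -/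
def GammaMin {n : ℕ} (L : Eu n → Eu n → ℝ) (a b : ℝ) (K₁ K₂ : Set (Eu n)) :
    Set (CPath a b n) :=
  {γ | IsACC γ ∧ pev γ a ∈ K₁ ∧ pev γ b ∈ K₂ ∧
    ∀ γ' : CPath a b n, IsACC γ' → pev γ' a = pev γ a → pev γ' b = pev γ b →
      action L a b γ ≤ action L a b γ'}

/-- The Lagrangian cost `c(x,y)`: the minimal action among absolutely continuous curves
from `x` to `y`. -/
def cost {n : ℕ} (L : Eu n → Eu n → ℝ) (a b : ℝ) (x y : Eu n) : EReal :=
  ⨅ γ ∈ {γ : CPath a b n | IsACC γ ∧ pev γ a = x ∧ pev γ b = y}, action L a b γ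

/-- The restriction of a continuous curve `ℝ → ℝⁿ` to `[a,b]` as an element of the path
space. -/
def toPath {n : ℕ} (a b : ℝ) (f : ℝ → Eu n) (hf : Continuous f) : CPath a b n :=
  (ContinuousMap.mk f hf).restrict (Set.Icc a b)

/-- `Φ : ℝⁿ × ℝⁿ → C([a,b];ℝⁿ)` is the Euler–Lagrange (Newton) flow map for the Lagrangian
`L(x,v) = (m/2)|v|² − V(x)`: it is continuous and `Φ(x,v)` is a `C²` solution of
`m γ'' = −∇V(γ)` with initial position `x` and initial velocity `v`. -/
def IsNewtonFlow {n : ℕ} (m : ℝ) (V : Eu n → ℝ) (a b : ℝ)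
    (Φ : Eu n × Eu n → CPath a b n) : Prop :=
  Continuous Φ ∧ ∀ x v : Eu n, ∃ f : ℝ → Eu n, ContDiff ℝ 2 f ∧
    (∀ t : Set.Icc a b, Φ (x, v) t = f t) ∧ f a = x ∧ deriv f a = v ∧
    ∀ t ∈ Set.Icc a b, m • deriv (deriv f) t = -gradient V (f t)

/-- The set of `C²` solutions of `m γ'' = −∇V(γ)` starting in `Ka` and ending in `Kb`,
viewed as a subset of the path space. -/
def NewtonSet {n : ℕ} (m : ℝ) (V : Eu n → ℝ) (a b : ℝ) (Ka Kb : Set (Eu n)) :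
    Set (CPath a b n) :=
  {γ | ∃ f : ℝ → Eu n, ContDiff ℝ 2 f ∧ (∀ t : Set.Icc a b, γ t = f t) ∧
    (∀ t ∈ Set.Icc a b, m • deriv (deriv f) t = -gradient V (f t)) ∧
    f a ∈ Ka ∧ f b ∈ Kb}

/-- `γ` is piecewise affine subordinate to the partition `a = τ₀ < … < τ_l = b`. -/
def PiecewiseAffine {n : ℕ} (a b : ℝ) (τ : ℕ → ℝ) (l : ℕ) (γ : CPath a b n) : Prop :=
  ∀ j < l, ∀ t : Set.Icc a b, (t : ℝ) ∈ Set.Icc (τ j) (τ (j + 1)) →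
    γ t = pev γ (τ j) + (((t : ℝ) - τ j) / (τ (j + 1) - τ j)) •
      (pev γ (τ (j + 1)) - pev γ (τ j))

/-- `IsPartition a b τ l h`: `a = τ₀ < τ₁ < … < τ_l = b` is a partition of `[a,b]` of mesh
at most `h`. -/
def IsPartition (a b : ℝ) (τ : ℕ → ℝ) (l : ℕ) (h : ℝ) : Prop :=
  1 ≤ l ∧ τ 0 = a ∧ τ l = b ∧ (∀ j < l, τ j < τ (j + 1)) ∧
    ∀ j < l, τ (j + 1) - τ j ≤ h

/-- The midpoint-rule discrete action, as a (real-valued) sum over the first `l` intervals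
of the partition. -/
def dActionSum {n : ℕ} (m : ℝ) (V : Eu n → ℝ) {a b : ℝ} (τ : ℕ → ℝ) (l : ℕ)
    (γ : CPath a b n) : ℝ :=
  ∑ j ∈ Finset.range l,
    (m / 2 * ‖pev γ (τ (j + 1)) - pev γ (τ j)‖ ^ 2 / (τ (j + 1) - τ j) -
      V ((2 : ℝ)⁻¹ • (pev γ (τ (j + 1)) + pev γ (τ j))) * (τ (j + 1) - τ j))

open Classical in
/-- The discrete action `𝒜^{[h]}`: the midpoint-rule discrete action for piecewise affine
curves subordinate to the partition, `+∞` otherwise. -/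
def dAction {n : ℕ} (m : ℝ) (V : Eu n → ℝ) (a b : ℝ) (τ : ℕ → ℝ) (l : ℕ)
    (γ : CPath a b n) : EReal :=
  if PiecewiseAffine a b τ l γ then ((dActionSum m V τ l γ : ℝ) : EReal) else ⊤

/-- The discrete Euler–Lagrange equations for a piecewise affine curve subordinate to the
partition `a = τ₀ < … < τ_l = b`. -/
def DiscreteEL {n : ℕ} (m : ℝ) (V : Eu n → ℝ) {a b : ℝ} (τ : ℕ → ℝ) (l : ℕ)
    (γ : CPath a b n) : Prop :=
  ∀ j, 1 ≤ j → j < l →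
    m • ((τ j - τ (j - 1))⁻¹ • (pev γ (τ j) - pev γ (τ (j - 1)))) -
      m • ((τ (j + 1) - τ j)⁻¹ • (pev γ (τ (j + 1)) - pev γ (τ j))) =
    ((τ j - τ (j - 1)) / 2) • gradient V ((2 : ℝ)⁻¹ • (pev γ (τ (j - 1)) + pev γ (τ j))) +
      ((τ (j + 1) - τ j) / 2) • gradient V ((2 : ℝ)⁻¹ • (pev γ (τ j) + pev γ (τ (j + 1))))

end

/-- A continuous map from a compact metrizable space has a Borel right inverse on its range. -/
theorem exists_measurable_section {K Y : Type*} [TopologicalSpace K]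
    [TopologicalSpace.MetrizableSpace K] [CompactSpace K] [Nonempty K]
    [MeasurableSpace K] [BorelSpace K] [TopologicalSpace Y] [T2Space Y] [MeasurableSpace Y]
    [BorelSpace Y] {g : K → Y} (hg : Continuous g) :
    ∃ s : Y → K, Measurable s ∧ ∀ y ∈ Set.range g, g (s y) = y := by
  classical
  let _ : MetricSpace K := TopologicalSpace.metrizableSpaceMetric K
  obtain ⟨φ, hφ, hφs⟩ := exists_nat_bool_continuous_surjective_of_compact K
  let ψ : cantorSet → K := φ ∘ cantorSetHomeomorphNatToBool
  have hψ : Continuous ψ := hφ.comp cantorSetHomeomorphNatToBool.continuous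
  have hψs : Function.Surjective ψ := hφs.comp cantorSetHomeomorphNatToBool.surjective
  have : Nonempty cantorSet := ⟨⟨0, zero_mem_cantorSet⟩⟩
  have : CompactSpace cantorSet := isCompact_iff_compactSpace.1 isCompact_cantorSet
  let F : cantorSet → Y := g ∘ ψ
  have hF : Continuous F := hg.comp hψ
  have hmin : ∀ y ∈ Set.range F, ∃ c : cantorSet, F c = y ∧ ∀ c', F c' = y → (c : ℝ) ≤ c' := by
    intro y hy
    have hc : IsCompact (F ⁻¹' {y}) := (isClosed_singleton.preimage hF).isCompact
    obtain ⟨c, hc, hm⟩ := hc.exists_isMinOn hy continuous_subtype_val.continuousOn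
    exact ⟨c, hc, fun c' hc' => hm hc'⟩
  choose! σ hσ1 hσ2 using hmin
  let τ : Y → cantorSet := fun y => if y ∈ Set.range F then σ y else ⟨0, zero_mem_cantorSet⟩
  have hrange : MeasurableSet (Set.range F) := (isCompact_range hF).measurableSet
  have hτ : Measurable τ := by
    have hval : Measurable fun y => (τ y : ℝ) := by
      refine measurable_of_Iic fun r => ?_
      have hC : MeasurableSet (F '' {c | (c : ℝ) ≤ r}) :=
        ((isClosed_le continuous_subtype_val continuous_const).isCompact.image hF).measurableSet
      have heq : (fun y => (τ y : ℝ)) ⁻¹' Set.Iic r =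
          F '' {c | (c : ℝ) ≤ r} ∪ ((Set.range F)ᶜ ∩ {_y | (0 : ℝ) ≤ r}) := by
        ext y
        simp only [Set.mem_preimage, Set.mem_Iic, Set.mem_union, Set.mem_image,
          Set.mem_inter_iff, Set.mem_compl_iff, Set.mem_ofPred_eq]
        by_cases hy : y ∈ Set.range F
        · simp only [τ, if_pos hy, hy, not_true, false_and, or_false]
          constructor
          · exact fun h => ⟨σ y, h, hσ1 y hy⟩
          · rintro ⟨c, hc, hcy⟩
            exact (hσ2 y hy c hcy).trans hc
        · simp only [τ, if_neg hy, hy, not_false_eq_true, true_and]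
          refine ⟨Or.inr, ?_⟩
          rintro (⟨c, -, hcy⟩ | h)
          · exact (hy ⟨c, hcy⟩).elim
          · exact h
      rw [heq]
      exact hC.union (hrange.compl.inter (MeasurableSet.const _))
    exact hval.subtype_mk
  refine ⟨ψ ∘ τ, hψ.measurable.comp hτ, ?_⟩
  rintro _ ⟨k, rfl⟩
  obtain ⟨c, rfl⟩ := hψs k
  have hm : g (ψ c) ∈ Set.range F := ⟨c, rfl⟩
  simp only [Function.comp, τ, if_pos hm]
  exact hσ1 _ hm

/-- If the range of a continuous map defined on the Baire space has positive measure,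
then so does the image of some compact set. -/
theorem exists_isCompact_measure_image_pos {Y : Type*} [TopologicalSpace Y] [T2Space Y]
    [MeasurableSpace Y] [BorelSpace Y] (ν : Measure Y) [ν.OuterRegular]
    {g : (ℕ → ℕ) → Y} (hg : Continuous g) (hpos : 0 < ν (Set.range g)) :
    ∃ K : Set (ℕ → ℕ), IsCompact K ∧ 0 < ν (g '' K) := by
  classical
  obtain ⟨c, hc0, hc⟩ := exists_between hpos
  let E : (ℕ → ℕ) → ℕ → Set (ℕ → ℕ) := fun k m => {x | ∀ i < m, x i ≤ k i}
  have step : ∀ (k : ℕ → ℕ) (m : ℕ), c < ν (g '' E k m) →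
      ∃ j, c < ν (g '' (E k m ∩ {x | x m ≤ j})) := by
    intro k m h
    have hU : g '' E k m = ⋃ j, g '' (E k m ∩ {x | x m ≤ j}) := by
      rw [← Set.image_iUnion, ← Set.inter_iUnion]
      congr 1
      ext x
      simp only [Set.mem_inter_iff, Set.mem_iUnion, Set.mem_ofPred_eq]
      exact ⟨fun h => ⟨h, x m, le_rfl⟩, fun h => h.1⟩
    have hmono : Monotone fun j => g '' (E k m ∩ {x | x m ≤ j}) := by
      intro i j hij
      refine Set.image_mono (Set.inter_subset_inter_right _ fun x hx => ?_)
      exact le_trans (show x m ≤ i from hx) hij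
    rw [hU, hmono.measure_iUnion, lt_iSup_iff] at h
    exact h
  have hEcongr : ∀ k k' m, (∀ i < m, k i = k' i) → E k m = E k' m := by
    intro k k' m h
    ext x
    simp only [E, Set.mem_ofPred_eq]
    exact forall₂_congr fun i hi => by rw [h i hi]
  have key : ∃ k : ℕ → ℕ, ∀ m, c < ν (g '' E k m) := by
    choose! J hJ using step
    let p : ℕ → (ℕ → ℕ) := fun m => Nat.rec (fun _ => 0) (fun m q => Function.update q m (J q m)) m
    have hp : ∀ m, p (m + 1) = Function.update (p m) m (J (p m) m) := fun m => rfl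
    have hpE : ∀ m, c < ν (g '' E (p m) m) := by
      intro m
      induction m with
      | zero => simpa [E, Set.image_univ] using hc
      | succ m ih =>
        refine (hJ _ _ ih).trans_le (measure_mono (Set.image_mono ?_))
        rintro x ⟨hx, hxm⟩ i hi
        rw [hp]
        rcases Nat.lt_succ_iff_lt_or_eq.1 hi with h | rfl
        · rw [Function.update_of_ne h.ne]
          exact hx i h
        · rw [Function.update_self]
          exact hxm
    have hstab : ∀ m i, i < m → p m i = p (i + 1) i := by
      intro m i hi
      induction m with
      | zero => omega
      | succ m ih =>
        rcases Nat.lt_succ_iff_lt_or_eq.1 hi with h | rfl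
        · rw [hp, Function.update_of_ne h.ne, ih h]
        · rfl
    refine ⟨fun i => p (i + 1) i, fun m => ?_⟩
    rw [← hEcongr (p m) _ m (fun i hi => hstab m i hi)]
    exact hpE m
  obtain ⟨k, hk⟩ := key
  let K : Set (ℕ → ℕ) := Set.univ.pi fun i => Set.Iic (k i)
  have hK : IsCompact K := isCompact_univ_pi fun i => (Set.finite_Iic (k i)).isCompact
  refine ⟨K, hK, hc0.trans_le ?_⟩
  by_contra! hlt
  obtain ⟨U, hKU, hU, hνU⟩ := Set.exists_isOpen_lt_of_lt _ _ hlt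
  have hnot : ∀ m, ∃ x ∈ E k m, g x ∉ U := by
    intro m
    by_contra! h
    exact (hk m).not_ge ((measure_mono (Set.image_subset_iff.2 h)).trans hνU.le)
  choose x hxE hxU using hnot
  let y : ℕ → ℕ → ℕ := fun m i => min (x m i) (k i)
  have hyK : ∀ m, y m ∈ K := fun m i _ => Set.mem_Iic.2 (min_le_right _ _)
  obtain ⟨z, hz, θ, hθ, hyz⟩ := hK.tendsto_subseq hyK
  have hxz : Tendsto (x ∘ θ) atTop (𝓝 z) := by
    rw [tendsto_pi_nhds] at hyz ⊢
    intro i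
    refine (hyz i).congr' ?_
    filter_upwards [eventually_gt_atTop i] with m hm
    exact min_eq_left (hxE (θ m) i (hm.trans_le (hθ.le_apply)))
  have hlim := (hg.tendsto z).comp hxz
  have hzU : g z ∈ U := hKU ⟨z, hz, rfl⟩
  obtain ⟨m, hm⟩ := (hlim.eventually (hU.mem_nhds hzU)).exists
  exact hxU _ hm

/-- If the image of a closed subset `S` of a Polish space under a continuous map has positive
measure, then the map has a Borel right inverse with values in `S` on a Borel set of positive
measure. -/
theorem exists_measurable_section_of_measure_image_pos {X Y : Type*} [TopologicalSpace X]
    [PolishSpace X] [MeasurableSpace X] [BorelSpace X] [TopologicalSpace Y] [T2Space Y]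
    [MeasurableSpace Y] [BorelSpace Y] (ν : Measure Y) [ν.OuterRegular] {g : X → Y}
    (hg : Continuous g) {S : Set X} (hS : IsClosed S) (hpos : 0 < ν (g '' S)) :
    ∃ (G : Set Y) (s : Y → X), MeasurableSet G ∧ 0 < ν G ∧ Measurable s ∧
      ∀ y ∈ G, s y ∈ S ∧ g (s y) = y := by
  have hSne : Nonempty S := by
    rw [Set.nonempty_coe_sort]
    by_contra! h
    simp [h] at hpos
  have := hS.polishSpace
  obtain ⟨φ, hφ, hφs⟩ := PolishSpace.exists_nat_nat_continuous_surjective S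
  have hφ' : Continuous fun z => (φ z : X) := continuous_subtype_val.comp hφ
  have hrange : Set.range (fun z => g (φ z)) = g '' S := by
    ext y
    constructor
    · rintro ⟨z, rfl⟩
      exact ⟨φ z, (φ z).2, rfl⟩
    · rintro ⟨x, hx, rfl⟩
      obtain ⟨z, hz⟩ := hφs ⟨x, hx⟩
      exact ⟨z, by simp [hz]⟩
  obtain ⟨K, hK, hKpos⟩ := exists_isCompact_measure_image_pos ν (hg.comp hφ')
    (by rw [← hrange] at hpos; exact hpos)
  have hKne : Nonempty K := by
    rw [Set.nonempty_coe_sort]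
    by_contra! h
    simp [h] at hKpos
  have := isCompact_iff_compactSpace.1 hK
  have hgK : Continuous fun z : K => g (φ z) := hg.comp (hφ'.comp continuous_subtype_val)
  obtain ⟨s, hs, hsec⟩ := exists_measurable_section hgK
  have hGeq : Set.range (fun z : K => g (φ z)) = (fun z => g (φ z)) '' K := by
    rw [Set.image_eq_range]
  refine ⟨Set.range fun z : K => g (φ z), fun y => φ (s y), (isCompact_range hgK).measurableSet,
    ?_, hφ'.measurable.comp (measurable_subtype_coe.comp hs), fun y hy => ⟨(φ _).2, hsec y hy⟩⟩
  rw [hGeq]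
  exact hKpos

/-- A Bochner-integrable function on `[a,b]` is determined almost everywhere by its primitive. -/
theorem ae_eq_of_primitive_eq {n : ℕ} {a b : ℝ} (hab : a ≤ b) {g g' : ℝ → Eu n}
    (hg : IntegrableOn g (Set.Icc a b)) (hg' : IntegrableOn g' (Set.Icc a b))
    (h : ∀ t ∈ Set.Icc a b, ∫ u in a..t, g u = ∫ u in a..t, g' u) :
    g =ᵐ[volume.restrict (Set.Icc a b)] g' := by
  have hi : IntervalIntegrable g volume a b :=
    (intervalIntegrable_iff_integrableOn_Icc_of_le hab).2 hg
  have hi' : IntervalIntegrable g' volume a b :=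
    (intervalIntegrable_iff_integrableOn_Icc_of_le hab).2 hg'
  rw [← Measure.restrict_congr_set Ioo_ae_eq_Icc, Filter.EventuallyEq,
    ae_restrict_iff' measurableSet_Ioo]
  filter_upwards [hi.ae_hasDerivAt_integral, hi'.ae_hasDerivAt_integral] with t h1 h2 ht
  rw [Set.uIcc_of_le hab] at h1 h2
  have ha : a ∈ Set.Icc a b := Set.left_mem_Icc.2 hab
  have ht' := Set.Ioo_subset_Icc_self ht
  refine (h1 ht' a ha).unique ((h2 ht' a ha).congr_of_eventuallyEq ?_)
  filter_upwards [Icc_mem_nhds ht.1 ht.2] with x hx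
  exact h x hx

/-- Initial positions and velocities of absolutely continuous curves on `[a,b]`. -/
abbrev CurveData (a b : ℝ) (n : ℕ) := Eu n × Lp (Eu n) 1 (volume.restrict (Set.Icc a b))

theorem CurveData.integrableOn {a b : ℝ} {n : ℕ} (p : CurveData a b n) :
    IntegrableOn p.2 (Set.Icc a b) := L1.integrable_coeFn p.2

theorem CurveData.intervalIntegrable {a b : ℝ} {n : ℕ} (p : CurveData a b n) {s t : ℝ}
    (hs : s ∈ Set.Icc a b) (ht : t ∈ Set.Icc a b) : IntervalIntegrable p.2 volume s t :=
  (p.integrableOn.mono_set (Set.uIcc_subset_Icc hs ht)).intervalIntegrable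

/-- The absolutely continuous curve with given initial position and velocity. -/
noncomputable def CurveData.curve {a b : ℝ} {n : ℕ} (p : CurveData a b n) : CPath a b n where
  toFun t := p.1 + ∫ u in a..(t : ℝ), p.2 u
  continuous_toFun := by
    have h := intervalIntegral.continuousOn_primitive_Icc p.integrableOn
    refine continuous_const.add ((continuousOn_iff_continuous_domRestrict.1 h).congr fun t => ?_)
    simp only [Set.domRestrict_apply]
    rw [intervalIntegral.integral_of_le t.2.1, integral_Icc_eq_integral_Ioc]

theorem CurveData.curve_apply {a b : ℝ} {n : ℕ} (p : CurveData a b n) (t : Set.Icc a b) :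
    p.curve t = p.1 + ∫ u in a..(t : ℝ), p.2 u := rfl

theorem CurveData.curve_eq_add {a b : ℝ} {n : ℕ} (p : CurveData a b n) (s t : Set.Icc a b) :
    p.curve t = p.curve s + ∫ u in (s : ℝ)..(t : ℝ), p.2 u := by
  have ha : a ∈ Set.Icc a b := Set.left_mem_Icc.2 (s.2.1.trans s.2.2)
  rw [curve_apply, curve_apply, add_assoc, intervalIntegral.integral_add_adjacent_intervals
    (p.intervalIntegrable ha s.2) (p.intervalIntegrable s.2 t.2)]

theorem CurveData.isACC_curve {a b : ℝ} {n : ℕ} (p : CurveData a b n) : IsACC p.curve :=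
  ⟨p.2, p.integrableOn, p.curve_eq_add⟩

theorem IsACC.exists_curveData {a b : ℝ} {n : ℕ} (hab : a ≤ b) {γ : CPath a b n} (h : IsACC γ) :
    ∃ p : CurveData a b n, p.curve = γ := by
  obtain ⟨g, hg, hγ⟩ := h
  refine ⟨(γ ⟨a, Set.left_mem_Icc.2 hab⟩, hg.integrable.toL1 g), ?_⟩
  ext1 t
  rw [CurveData.curve_apply, hγ ⟨a, Set.left_mem_Icc.2 hab⟩ t]
  congr 1
  rw [intervalIntegral.integral_of_le t.2.1, intervalIntegral.integral_of_le t.2.1]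
  refine integral_congr_ae (ae_restrict_of_ae_restrict_of_subset ?_ hg.integrable.coeFn_toL1)
  exact fun u hu => ⟨hu.1.le, hu.2.trans t.2.2⟩

theorem CurveData.curve_injective {a b : ℝ} {n : ℕ} (hab : a ≤ b) :
    Function.Injective (CurveData.curve : CurveData a b n → CPath a b n) := by
  intro p q h
  have hx : p.1 = q.1 := by
    have := DFunLike.congr_fun h ⟨a, Set.left_mem_Icc.2 hab⟩
    simpa [curve_apply] using this
  refine Prod.ext hx (Lp.ext (ae_eq_of_primitive_eq hab p.integrableOn q.integrableOn ?_))
  intro t ht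
  have := DFunLike.congr_fun h ⟨t, ht⟩
  simpa [curve_apply, hx] using this

theorem CurveData.dist_curve_le {a b : ℝ} {n : ℕ} (p q : CurveData a b n) :
    dist p.curve q.curve ≤ dist p.1 q.1 + dist p.2 q.2 := by
  refine (ContinuousMap.dist_le (by positivity)).2 fun t => ?_
  have ha : a ∈ Set.Icc a b := Set.left_mem_Icc.2 (t.2.1.trans t.2.2)
  rw [curve_apply, curve_apply]
  refine (dist_add_add_le _ _ _ _).trans (add_le_add le_rfl ?_)
  rw [dist_eq_norm, ← intervalIntegral.integral_sub (p.intervalIntegrable ha t.2)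
    (q.intervalIntegrable ha t.2), L1.dist_eq_integral_dist]
  simp only [dist_eq_norm]
  refine (intervalIntegral.norm_integral_le_integral_norm t.2.1).trans ?_
  rw [intervalIntegral.integral_of_le t.2.1]
  refine setIntegral_mono_set (p.integrableOn.sub q.integrableOn).norm
    (Eventually.of_forall fun _ => norm_nonneg _) (LE.le.eventuallyLE ?_)
  exact fun u hu => ⟨hu.1.le, hu.2.trans t.2.2⟩

theorem CurveData.continuous_curve {a b : ℝ} {n : ℕ} :
    Continuous (CurveData.curve : CurveData a b n → CPath a b n) := by
  refine continuous_iff_continuousAt.2 fun p => tendsto_iff_dist_tendsto_zero.2 ?_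
  refine squeeze_zero (fun _ => dist_nonneg) (fun q => q.dist_curve_le p) ?_
  have : Continuous fun q : CurveData a b n => dist q.1 p.1 + dist q.2 p.2 := by fun_prop
  simpa using this.tendsto p

theorem continuousOn_pev {a b : ℝ} {n : ℕ} (γ : CPath a b n) :
    ContinuousOn (pev γ) (Set.Icc a b) := by
  refine continuousOn_iff_continuous_domRestrict.2 (γ.continuous.congr fun t => ?_)
  simp [pev]

theorem continuous_pev {a b : ℝ} {n : ℕ} (t : ℝ) :
    Continuous fun γ : CPath a b n => pev γ t := by
  by_cases ht : t ∈ Set.Icc a b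
  · simp only [pev, dif_pos ht]
    exact continuous_eval_const _
  · simp only [pev, dif_neg ht]
    exact continuous_const

/-- The integral along a curve of the Lagrangian shifted by a constant `c`. -/
noncomputable def CurveData.shiftedAction {a b : ℝ} {n : ℕ} (L : Eu n → Eu n → ℝ) (c : ℝ)
    (p : CurveData a b n) : ℝ≥0∞ :=
  ∫⁻ t in Set.Icc a b, ENNReal.ofReal (L (pev p.curve t) (p.2 t) + c)

theorem CurveData.aestronglyMeasurable_lagrangian {a b : ℝ} {n : ℕ} {L : Eu n → Eu n → ℝ}
    (hL : Continuous (Function.uncurry L)) (p : CurveData a b n) :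
    AEStronglyMeasurable (fun t => L (pev p.curve t) (p.2 t))
      (volume.restrict (Set.Icc a b)) :=
  hL.comp_aestronglyMeasurable
    (((continuousOn_pev p.curve).aestronglyMeasurable measurableSet_Icc).prodMk
      (Lp.aestronglyMeasurable p.2))

theorem CurveData.action_curve {a b : ℝ} {n : ℕ} (hab : a ≤ b) {L : Eu n → Eu n → ℝ}
    (hL : Continuous (Function.uncurry L)) {c : ℝ} (hc : ∀ x v, 0 ≤ L x v + c)
    (p : CurveData a b n) :
    action L a b p.curve = (p.shiftedAction L c : EReal) - ((c * (b - a) : ℝ) : EReal) := by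
  have hA := p.isACC_curve
  obtain ⟨hgi, hgγ⟩ := hA.choose_spec
  have hae : hA.choose =ᵐ[volume.restrict (Set.Icc a b)] p.2 := by
    refine ae_eq_of_primitive_eq hab hgi p.integrableOn fun t ht => ?_
    have h1 := hgγ ⟨a, Set.left_mem_Icc.2 hab⟩ ⟨t, ht⟩
    have h2 := p.curve_eq_add ⟨a, Set.left_mem_Icc.2 hab⟩ ⟨t, ht⟩
    exact add_left_cancel (h1.symm.trans h2)
  have hLae : (fun t => L (pev p.curve t) (hA.choose t)) =ᵐ[volume.restrict (Set.Icc a b)]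
      fun t => L (pev p.curve t) (p.2 t) := by
    filter_upwards [hae] with t ht
    rw [ht]
  have hm := p.aestronglyMeasurable_lagrangian hL
  have hnn : 0 ≤ᵐ[volume.restrict (Set.Icc a b)] fun t => L (pev p.curve t) (p.2 t) + c :=
    Eventually.of_forall fun t => hc _ _
  have hci : Integrable (fun _ => c) (volume.restrict (Set.Icc a b)) := integrable_const c
  have hiff : IntegrableOn (fun t => L (pev p.curve t) (hA.choose t)) (Set.Icc a b) ↔
      Integrable (fun t => L (pev p.curve t) (p.2 t)) (volume.restrict (Set.Icc a b)) :=
    integrable_congr hLae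
  by_cases hi : Integrable (fun t => L (pev p.curve t) (p.2 t)) (volume.restrict (Set.Icc a b))
  · have hsum : Integrable (fun t => L (pev p.curve t) (p.2 t) + c)
        (volume.restrict (Set.Icc a b)) := hi.add hci
    refine (dif_pos hA).trans ((if_pos (hiff.2 hi)).trans ?_)
    rw [integral_congr_ae hLae, shiftedAction, ← ofReal_integral_eq_lintegral_ofReal hsum hnn,
      integral_add hi hci, EReal.coe_ennreal_ofReal, max_eq_left, ← EReal.coe_sub]
    · congr 1
      simp [hab]
      ring
    · rw [← integral_add hi hci]
      exact integral_nonneg_of_ae hnn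
  · have htop : p.shiftedAction L c = ⊤ := by
      by_contra h
      have := (lintegral_ofReal_ne_top_iff_integrable (hm.add hci.aestronglyMeasurable) hnn).1 h
      exact hi (by simpa using this.sub hci)
    refine (dif_pos hA).trans ((if_neg (hiff.not.2 hi)).trans ?_)
    rw [htop]
    rfl

theorem CurveData.lowerSemicontinuous_shiftedAction {a b : ℝ} {n : ℕ} {L : Eu n → Eu n → ℝ}
    (hL : Continuous (Function.uncurry L)) (c : ℝ) :
    LowerSemicontinuous (CurveData.shiftedAction L c : CurveData a b n → ℝ≥0∞) := by
  refine lowerSemicontinuous_iff_isClosed_preimage.2 fun y => IsSeqClosed.isClosed ?_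
  intro p q hp hpq
  have h2 : Tendsto (fun k => (p k).2) atTop (𝓝 q.2) := (continuous_snd.tendsto q).comp hpq
  obtain ⟨θ, hθ, hae⟩ := (tendstoInMeasure_of_tendsto_Lp h2).exists_seq_tendsto_ae
  have hle : q.shiftedAction L c ≤ liminf (fun k => (p (θ k)).shiftedAction L c) atTop := by
    refine le_trans (lintegral_mono_ae ?_) (lintegral_liminf_le' fun k => ?_)
    · filter_upwards [hae] with t ht
      have h1 : Tendsto (fun k => pev (p (θ k)).curve t) atTop (𝓝 (pev q.curve t)) :=
        (((continuous_pev t).comp continuous_curve).tendsto q).comp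
          (hpq.comp hθ.tendsto_atTop)
      have h3 := ((ENNReal.continuous_ofReal.comp
        (hL.add (continuous_const (y := c)))).tendsto (pev q.curve t, q.2 t)).comp (h1.prodMk_nhds ht)
      exact h3.liminf_eq.ge
    · exact ((((p (θ k)).aestronglyMeasurable_lagrangian hL).add
        aestronglyMeasurable_const).aemeasurable).ennreal_ofReal
  refine hle.trans ?_
  refine liminf_le_of_le (by isBoundedDefault) fun z hz => ?_
  obtain ⟨k, hk⟩ := hz.exists
  exact hk.trans (hp (θ k))

theorem IsACC.of_action_ne_top {a b : ℝ} {n : ℕ} {L : Eu n → Eu n → ℝ} {γ : CPath a b n}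
    (h : action L a b γ ≠ ⊤) : IsACC γ := by
  by_contra hγ
  exact h (dif_neg hγ)

theorem neg_le_action {a b : ℝ} {n : ℕ} (hab : a ≤ b) {L : Eu n → Eu n → ℝ}
    (hL : Continuous (Function.uncurry L)) {c : ℝ} (hc : ∀ x v, 0 ≤ L x v + c)
    (γ : CPath a b n) : ((-(c * (b - a)) : ℝ) : EReal) ≤ action L a b γ := by
  by_cases hγ : IsACC γ
  · obtain ⟨p, rfl⟩ := hγ.exists_curveData hab
    rw [p.action_curve hab hL hc, EReal.coe_neg, ← zero_sub]
    exact EReal.sub_le_sub (EReal.coe_ennreal_nonneg _) le_rfl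
  · have h : action L a b γ = ⊤ := dif_neg hγ
    exact h ▸ le_top

instance CurveData.polishSpace {a b : ℝ} {n : ℕ} : PolishSpace (CurveData a b n) := by
  have : Fact ((1 : ℝ≥0∞) ≠ ⊤) := ⟨ENNReal.one_ne_top⟩
  infer_instance

theorem measurable_action {a b : ℝ} {n : ℕ} (hab : a ≤ b) {L : Eu n → Eu n → ℝ}
    (hL : Continuous (Function.uncurry L)) {c : ℝ} (hc : ∀ x v, 0 ≤ L x v + c) :
    Measurable (action L a b : CPath a b n → EReal) := by
  let _ : MeasurableSpace (CurveData a b n) := borel _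
  have : BorelSpace (CurveData a b n) := ⟨rfl⟩
  have hemb : MeasurableEmbedding (CurveData.curve : CurveData a b n → CPath a b n) :=
    CurveData.continuous_curve.measurableEmbedding (CurveData.curve_injective hab)
  have hm : Measurable fun p : CurveData a b n => action L a b p.curve := by
    simp only [CurveData.action_curve hab hL hc]
    exact (CurveData.lowerSemicontinuous_shiftedAction hL c).measurable.coe_ereal_ennreal.sub_const _
  convert hemb.measurable_extend hm (measurable_const (a := ⊤)) using 1
  funext γ
  by_cases hγ : γ ∈ Set.range (CurveData.curve : CurveData a b n → CPath a b n)
  · obtain ⟨p, rfl⟩ := hγ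
    rw [(CurveData.curve_injective hab).extend_apply]
  · rw [Function.extend_apply' _ _ _ hγ]
    exact dif_neg fun h => hγ (h.exists_curveData hab)

theorem isClosed_action_curve_le {a b : ℝ} {n : ℕ} (hab : a ≤ b) {L : Eu n → Eu n → ℝ}
    (hL : Continuous (Function.uncurry L)) {c : ℝ} (hc : ∀ x v, 0 ≤ L x v + c) (r : ℝ) :
    IsClosed {p : CurveData a b n | action L a b p.curve ≤ r} := by
  have hlsc : LowerSemicontinuous fun p : CurveData a b n => (p.shiftedAction L c : EReal) :=
    continuous_coe_ennreal_ereal.comp_lowerSemicontinuous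
      (CurveData.lowerSemicontinuous_shiftedAction hL c) EReal.coe_ennreal_strictMono.monotone
  convert hlsc.isClosed_preimage (r + ((c * (b - a) : ℝ) : EReal)) using 1
  ext p
  rw [Set.mem_ofPred_eq, p.action_curve hab hL hc, Set.mem_preimage, Set.mem_Iic,
    EReal.sub_le_iff_le_add (Or.inl (EReal.coe_ne_bot _)) (Or.inl (EReal.coe_ne_top _))]

theorem epos_eq_toENNReal (x : EReal) : epos x = x.toENNReal := by
  simp only [epos, EReal.toENNReal]

theorem eq_of_epos_eq {x y : EReal} (h : epos x = epos y) (h' : epos (-x) = epos (-y)) :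
    x = y := by
  simp only [epos_eq_toENNReal] at h h'
  rcases le_total 0 x with hx | hx
  · rcases le_or_gt 0 y with hy | hy
    · exact (EReal.toENNReal_eq_toENNReal hx hy).1 h
    · rw [EReal.toENNReal_of_nonpos (EReal.neg_le_zero.2 hx), eq_comm,
        EReal.toENNReal_eq_zero_iff, EReal.neg_le_zero] at h'
      exact (hy.not_ge h').elim
  · have hx' : 0 ≤ -x := EReal.neg_nonneg.2 hx
    rcases le_or_gt y 0 with hy | hy
    · exact neg_injective ((EReal.toENNReal_eq_toENNReal hx' (EReal.neg_nonneg.2 hy)).1 h')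
    · rw [EReal.toENNReal_of_nonpos hx, eq_comm, EReal.toENNReal_eq_zero_iff] at h
      exact (hy.not_ge h).elim

section mint

variable {X : Type*} [MeasurableSpace X] {F G : X → EReal} {π : Measure X}

theorem Measurable.epos (hF : Measurable F) : Measurable fun x => epos (F x) := by
  simp only [epos_eq_toENNReal]
  exact hF.ereal_toENNReal

theorem mint_map {Z : Type*} [MeasurableSpace Z] {H : Z → EReal} {T : X → Z} (hH : Measurable H)
    (hT : Measurable T) : mint H (π.map T) = mint (H ∘ T) π := by
  have hN : Measurable fun z => epos (-H z) := Measurable.epos (F := fun z => -H z) hH.neg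
  rw [mint, mint, lintegral_map hH.epos hT, lintegral_map hN hT]
  rfl

theorem lintegral_epos_neg_lt_top [IsFiniteMeasure π] {m : ℝ} (hm : ∀ x, (m : EReal) ≤ F x) :
    ∫⁻ x, epos (-F x) ∂π < ⊤ := by
  refine (lintegral_mono (g := fun _ => ENNReal.ofReal (-m)) fun x => ?_).trans_lt ?_
  · simp only [epos_eq_toENNReal]
    rw [← EReal.real_coe_toENNReal, EReal.coe_neg]
    exact EReal.toENNReal_le_toENNReal (EReal.neg_le_neg_iff.2 (hm x))
  · rw [lintegral_const]
    exact ENNReal.mul_lt_top ENNReal.ofReal_lt_top (measure_lt_top _ _)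

theorem lintegral_epos_lt_top [IsFiniteMeasure π] {m : ℝ} (hm : ∀ x, (m : EReal) ≤ F x)
    (hfin : mint F π < ⊤) : ∫⁻ x, epos (F x) ∂π < ⊤ := by
  rw [lt_top_iff_ne_top]
  intro h
  rw [mint, h, EReal.coe_ennreal_top, EReal.top_sub] at hfin
  · exact hfin.ne rfl
  · rw [Ne, EReal.coe_ennreal_eq_top_iff]
    exact (lintegral_epos_neg_lt_top hm).ne

theorem ae_ne_top_of_mint_lt_top [IsFiniteMeasure π] (hF : Measurable F) {m : ℝ}
    (hm : ∀ x, (m : EReal) ≤ F x) (hfin : mint F π < ⊤) : ∀ᵐ x ∂π, F x ≠ ⊤ := by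
  filter_upwards [ae_lt_top hF.epos (lintegral_epos_lt_top hm hfin).ne] with x hx h
  simp [h, epos] at hx

theorem ae_eq_of_mint_le [IsFiniteMeasure π] (hF : Measurable F) (hG : Measurable G) {m : ℝ}
    (hm : ∀ x, (m : EReal) ≤ G x) (hGF : ∀ x, G x ≤ F x) (hfin : mint F π < ⊤)
    (hle : mint F π ≤ mint G π) : F =ᵐ[π] G := by
  have hmF : ∀ x, (m : EReal) ≤ F x := fun x => (hm x).trans (hGF x)
  have hpos : ∀ x, epos (G x) ≤ epos (F x) := fun x => by
    simpa only [epos_eq_toENNReal] using EReal.toENNReal_le_toENNReal (hGF x)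
  have hneg : ∀ x, epos (-F x) ≤ epos (-G x) := fun x => by
    simpa only [epos_eq_toENNReal] using
      EReal.toENNReal_le_toENNReal (EReal.neg_le_neg_iff.2 (hGF x))
  have hP := lintegral_epos_lt_top hmF hfin
  have hN := lintegral_epos_neg_lt_top (π := π) hm
  have hP' := lintegral_mono (μ := π) hpos
  have hN' := lintegral_mono (μ := π) hneg
  have hPG := hP'.trans_lt hP
  have hNF := hN'.trans_lt hN
  have hPr := (ENNReal.toReal_le_toReal hPG.ne hP.ne).2 hP'
  have hNr := (ENNReal.toReal_le_toReal hNF.ne hN.ne).2 hN'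
  have hr : (∫⁻ x, epos (F x) ∂π).toReal - (∫⁻ x, epos (-F x) ∂π).toReal ≤
      (∫⁻ x, epos (G x) ∂π).toReal - (∫⁻ x, epos (-G x) ∂π).toReal := by
    unfold mint at hle
    rw [← EReal.coe_ennreal_toReal hP.ne, ← EReal.coe_ennreal_toReal hN.ne,
      ← EReal.coe_ennreal_toReal hPG.ne, ← EReal.coe_ennreal_toReal hNF.ne] at hle
    exact_mod_cast hle
  have e1 : ∫⁻ x, epos (F x) ∂π ≤ ∫⁻ x, epos (G x) ∂π :=
    (ENNReal.toReal_le_toReal hP.ne hPG.ne).1 (by linarith)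
  have e2 : ∫⁻ x, epos (-G x) ∂π ≤ ∫⁻ x, epos (-F x) ∂π :=
    (ENNReal.toReal_le_toReal hN.ne hNF.ne).1 (by linarith)
  filter_upwards [ae_eq_of_ae_le_of_lintegral_le (Eventually.of_forall hpos) hPG.ne
      hF.epos.aemeasurable e1,
    ae_eq_of_ae_le_of_lintegral_le (Eventually.of_forall hneg) hNF.ne
      hG.neg.epos.aemeasurable e2] with x h1 h2
  exact eq_of_epos_eq h1.symm h2

end mint

theorem measure_compl_msupp {α : Type*} [TopologicalSpace α] [SecondCountableTopology α]
    [MeasurableSpace α] (μ : Measure α) : μ (msupp μ)ᶜ = 0 := by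
  refine measure_null_of_locally_null _ fun x hx => ?_
  simp only [msupp, Set.mem_compl_iff, Set.mem_ofPred_eq, not_forall, not_lt,
    nonpos_iff_eq_zero] at hx
  obtain ⟨U, hU, hxU, h0⟩ := hx
  exact ⟨U, mem_nhdsWithin_of_mem_nhds (hU.mem_nhds hxU), h0⟩

/-- The pair of endpoints of a curve. -/
noncomputable def endpoints {a b : ℝ} {n : ℕ} (γ : CPath a b n) : Eu n × Eu n := (pev γ a, pev γ b)

theorem continuous_endpoints {a b : ℝ} {n : ℕ} :
    Continuous (endpoints : CPath a b n → Eu n × Eu n) :=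
  (continuous_pev a).prodMk (continuous_pev b)

/-- If a measure `π` minimizes the action among its images under Borel maps preserving endpoints,
then almost no curve of action exceeding `r` has the same endpoints as a curve of action at most
`r`. -/
theorem measure_improvable_eq_zero {a b : ℝ} {n : ℕ} (hab : a ≤ b) {L : Eu n → Eu n → ℝ}
    (hL : Continuous (Function.uncurry L)) {c : ℝ} (hc : ∀ x v, 0 ≤ L x v + c)
    {π : Measure (CPath a b n)} [IsFiniteMeasure π] (hfin : mint (action L a b) π < ⊤)
    (hmin : ∀ T : CPath a b n → CPath a b n, Measurable T →
      (∀ γ, endpoints (T γ) = endpoints γ) →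
        mint (action L a b) π ≤ mint (action L a b) (π.map T)) (r : ℝ) :
    π ({γ | (r : EReal) < action L a b γ} ∩
      endpoints ⁻¹' (endpoints '' {γ | action L a b γ ≤ r})) = 0 := by
  classical
  have hA := measurable_action (n := n) hab hL hc
  set P : Set (CPath a b n) := {γ | (r : EReal) < action L a b γ}
  have hP : MeasurableSet P := measurableSet_lt measurable_const hA
  have he : Measurable (endpoints : CPath a b n → Eu n × Eu n) := continuous_endpoints.measurable
  let ν := (π.restrict P).map endpoints
  let _ : MeasurableSpace (CurveData a b n) := borel _
  have : BorelSpace (CurveData a b n) := ⟨rfl⟩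
  by_contra hne
  have himage : endpoints '' {γ : CPath a b n | action L a b γ ≤ r} ⊆
      (fun p : CurveData a b n => endpoints p.curve) '' {p | action L a b p.curve ≤ r} := by
    rintro _ ⟨γ, hγ, rfl⟩
    obtain ⟨p, rfl⟩ :=
      (IsACC.of_action_ne_top (ne_top_of_le_ne_top (EReal.coe_ne_top r) hγ)).exists_curveData hab
    exact ⟨p, hγ, rfl⟩
  have hpos : 0 < ν ((fun p : CurveData a b n => endpoints p.curve) ''
      {p | action L a b p.curve ≤ r}) := by
    refine (pos_iff_ne_zero.2 hne).trans_le (le_trans ?_ (measure_mono himage))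
    refine le_trans ?_ (Measure.le_map_apply he.aemeasurable _)
    rw [Set.inter_comm]
    exact Measure.le_restrict_apply _ _
  obtain ⟨G, s, hG, hGpos, hs, hsG⟩ := exists_measurable_section_of_measure_image_pos ν
    (continuous_endpoints.comp CurveData.continuous_curve)
    (isClosed_action_curve_le hab hL hc r) hpos
  have hB : MeasurableSet (P ∩ endpoints ⁻¹' G) := hP.inter (he hG)
  have hBpos : 0 < π (P ∩ endpoints ⁻¹' G) := by
    rw [Measure.map_apply he hG, Measure.restrict_apply (he hG), Set.inter_comm] at hGpos
    exact hGpos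
  let T : CPath a b n → CPath a b n :=
    (P ∩ endpoints ⁻¹' G).piecewise (fun γ => (s (endpoints γ)).curve) id
  have hT : Measurable T :=
    (CurveData.continuous_curve.measurable.comp (hs.comp he)).piecewise hB measurable_id
  have hTin : ∀ γ ∈ P ∩ endpoints ⁻¹' G, T γ = (s (endpoints γ)).curve :=
    fun _ hγ => Set.piecewise_eq_of_mem _ _ _ hγ
  have hTout : ∀ γ ∉ P ∩ endpoints ⁻¹' G, T γ = γ :=
    fun _ hγ => Set.piecewise_eq_of_notMem _ _ _ hγ
  have hTe : ∀ γ, endpoints (T γ) = endpoints γ := by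
    intro γ
    by_cases hγ : γ ∈ P ∩ endpoints ⁻¹' G
    · rw [hTin γ hγ]
      exact (hsG _ hγ.2).2
    · rw [hTout γ hγ]
  have hlt : ∀ γ ∈ P ∩ endpoints ⁻¹' G, action L a b (T γ) < action L a b γ := by
    intro γ hγ
    rw [hTin γ hγ]
    exact (hsG _ hγ.2).1.trans_lt hγ.1
  have hle : ∀ γ, action L a b (T γ) ≤ action L a b γ := by
    intro γ
    by_cases hγ : γ ∈ P ∩ endpoints ⁻¹' G
    · exact (hlt γ hγ).le
    · rw [hTout γ hγ]
  have hae := ae_eq_of_mint_le hA (hA.comp hT) (fun γ => neg_le_action hab hL hc (T γ)) hle hfin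
    ((hmin T hT hTe).trans_eq (mint_map hA hT))
  refine hBpos.ne' (measure_mono_null (fun γ hγ => ?_) (ae_iff.1 hae))
  exact (hlt γ hγ).ne'

/-- **Minimizers are concentrated on minimizing extremals (Theorem 3.4(i)).**
If `π` is a minimizer of `𝔸_{μ_a,μ_b}` with finite value, then `π` is concentrated on the
set `Γ^min_{K_a,K_b}` of minimizing extremals from `K_a = supp μ_a` to `K_b = supp μ_b`. -/
theorem minimizers_concentrated_on_minimizing_extremals
    {n : ℕ} (hn : 1 ≤ n) {a b : ℝ} (hab : a < b)
    (L : Eu n → Eu n → ℝ)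
    (hL1 : ContDiff ℝ (⊤ : ℕ∞) (Function.uncurry L))
    (hL2 : ∀ K : Set (Eu n), IsCompact K → ∃ c₀ : ℝ, 0 < c₀ ∧
      ∀ x ∈ K, ∀ v w : Eu n, c₀ * ‖w‖ ^ 2 ≤ fderiv ℝ (fderiv ℝ (L x)) v w w)
    (c₁ c₂ : ℝ) (hc₁ : 0 < c₁) (hc₂ : 0 < c₂)
    (hL3 : ∀ x v : Eu n, c₁ * ‖v‖ - c₂ ≤ L x v)
    (μa μb : Measure (Eu n)) [IsProbabilityMeasure μa] [IsProbabilityMeasure μb]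
    (hμaC : ∃ K : Set (Eu n), IsCompact K ∧ μa K = 1)
    (hμbC : ∃ K : Set (Eu n), IsCompact K ∧ μb K = 1)
    (hμaAC : μa ≪ volume) (hμbAC : μb ≪ volume)
    (π : Measure (CPath a b n)) [IsProbabilityMeasure π]
    (hmin : ∀ π' : Measure (CPath a b n), IsProbabilityMeasure π' →
      aFun (action L a b) μa μb π ≤ aFun (action L a b) μa μb π')
    (hfin : aFun (action L a b) μa μb π < ⊤) :
    π (GammaMin L a b (msupp μa) (msupp μb)) = 1 := by
  have hL : Continuous (Function.uncurry L) := hL1.continuous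
  have hc : ∀ x v, 0 ≤ L x v + c₂ := fun x v => by
    have := hL3 x v
    have := mul_nonneg hc₁.le (norm_nonneg v)
    linarith
  have hA := measurable_action (n := n) hab.le hL hc
  have hmarg : π.map (fun γ => pev γ a) = μa ∧ π.map (fun γ => pev γ b) = μb := by
    by_contra h
    exact hfin.ne (if_neg h)
  have haFun : aFun (action L a b) μa μb π = mint (action L a b) π := if_pos hmarg
  rw [haFun] at hfin
  have himp := measure_improvable_eq_zero hab.le hL hc hfin fun T hT hTe => by
    have hTa : ∀ t, t = a ∨ t = b →
        (π.map T).map (fun γ => pev γ t) = π.map (fun γ => pev γ t) := by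
      intro t ht
      rw [Measure.map_map (continuous_pev t).measurable hT]
      congr 1
      funext γ
      rcases ht with rfl | rfl
      · exact congrArg Prod.fst (hTe γ)
      · exact congrArg Prod.snd (hTe γ)
    have h := hmin (π.map T) (Measure.isProbabilityMeasure_map hT.aemeasurable)
    rwa [haFun, aFun, if_pos] at h
    exact ⟨(hTa a (Or.inl rfl)).trans hmarg.1, (hTa b (Or.inr rfl)).trans hmarg.2⟩
  have hsupp : ∀ t, ∀ᵐ γ ∂π, pev γ t ∈ msupp (π.map fun γ => pev γ t) := fun t =>
    ae_of_ae_map (continuous_pev t).measurable.aemeasurable (measure_compl_msupp _)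
  have himp' : ∀ᵐ γ ∂π, ∀ q : ℚ, ¬ (((q : ℝ) : EReal) < action L a b γ ∧
      endpoints γ ∈ endpoints '' {γ' : CPath a b n | action L a b γ' ≤ (q : ℝ)}) :=
    ae_all_iff.2 fun q => measure_eq_zero_iff_ae_notMem.1 (himp q)
  have hae : ∀ᵐ γ ∂π, γ ∈ GammaMin L a b (msupp μa) (msupp μb) := by
    filter_upwards [hsupp a, hsupp b, himp',
      ae_ne_top_of_mint_lt_top hA (neg_le_action hab.le hL hc) hfin] with γ h1 h2 h3 h4
    rw [hmarg.1] at h1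
    rw [hmarg.2] at h2
    refine ⟨IsACC.of_action_ne_top h4, h1, h2, fun γ' _ hγ'a hγ'b => ?_⟩
    by_contra! hlt
    obtain ⟨q, hq1, hq2⟩ := EReal.lt_iff_exists_rat_btwn.1 hlt
    exact h3 q ⟨hq2, γ', hq1.le, Prod.ext hγ'a hγ'b⟩
  have h : GammaMin L a b (msupp μa) (msupp μb) =ᵐ[π] Set.univ := eventuallyEq_univ.2 hae
  exact (measure_congr h).trans measure_univ
end

section
/- (Convergence of stationary points, Theorem 3.10.) Let K_a, K_b ⊆ ℝⁿ be compact and C > 0. For each N let γ_1^{(N)},…,γ_N^{(N)} : [a,b] → ℝⁿ be twice continuously differentiable curves, each solving the Euler–Lagrange (Newton) equation m γ''(t) = −∇V(γ(t)) for all t ∈ [a,b], with γ_i^{(N)}(a) ∈ K_a, γ_i^{(N)}(b) ∈ K_b for all i, and with average action (1/N)∑_{i=1}^N 𝒜(γ_i^{(N)}) ≤ C. Set π^{(N)} := (1/N)∑_{i=1}^N δ_{γ_i^{(N)}} ∈ 𝒫(C([a,b];ℝⁿ)). Then there exist a subsequence of (π^{(N)}) and π ∈ 𝒫(C([a,b];ℝⁿ))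 such that the subsequence converges weakly to π; moreover π(Γ_{K_a,K_b}) = 1, where Γ_{K_a,K_b} is the set of twice continuously differentiable curves γ with mγ''(t) = −∇V(γ(t)) for all t, γ(a) ∈ K_a and γ(b) ∈ K_b, and there exists a Borel probability measure η on ℝⁿ × ℝⁿ with π = Φ#η. -/
open MeasureTheory Filter Topology
open scoped ENNReal NNReal

/-- Conservation of energy along a solution of Newton's equation. -/
theorem newton_energy_eq {n : ℕ} {a b m : ℝ} {V : Eu n → ℝ} (hV : Differentiable ℝ V)
    {f : ℝ → Eu n} (hf : ContDiff ℝ 2 f)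
    (hEL : ∀ t ∈ Set.Icc a b, m • deriv (deriv f) t = -gradient V (f t))
    {t : ℝ} (ht : t ∈ Set.Icc a b) :
    m / 2 * ‖deriv f t‖ ^ 2 + V (f t) = m / 2 * ‖deriv f a‖ ^ 2 + V (f a) := by
  have hd : ∀ s, HasDerivAt f (deriv f s) s := fun s =>
    (hf.differentiable (by norm_num) s).hasDerivAt
  have hdd : ∀ s, HasDerivAt (deriv f) (deriv (deriv f) s) s := fun s =>
    (hf.differentiable_deriv_two s).hasDerivAt
  have hE : ∀ s, HasDerivAt (fun s => m / 2 * ‖deriv f s‖ ^ 2 + V (f s))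
      (m / 2 * (2 * inner ℝ (deriv f s) (deriv (deriv f) s)) +
        inner ℝ (gradient V (f s)) (deriv f s)) s := by
    intro s
    refine ((hdd s).norm_sq.const_mul _).add ?_
    have := (hV (f s)).hasFDerivAt.comp_hasDerivAt s (hd s)
    rwa [← inner_gradient_left] at this
  refine constant_of_has_deriv_right_zero (fun s _ => (hE s).continuousAt.continuousWithinAt)
    (fun s hs => ?_) t ht
  have h0 : m / 2 * (2 * inner ℝ (deriv f s) (deriv (deriv f) s)) +
      inner ℝ (gradient V (f s)) (deriv f s) = 0 := by
    have h1 : gradient V (f s) = -(m • deriv (deriv f) s) := by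
      rw [hEL s (Set.Ico_subset_Icc_self hs), neg_neg]
    rw [h1, inner_neg_left, real_inner_smul_left, real_inner_comm]
    ring
  exact h0 ▸ (hE s).hasDerivWithinAt

/-- The density of an absolutely continuous curve which is differentiable is a.e. equal to its
derivative. -/
theorem ae_eq_deriv_of_forall_eq_add_integral {n : ℕ} {a b : ℝ} (hab : a ≤ b)
    {f g : ℝ → Eu n} (hg : IntegrableOn g (Set.Icc a b))
    (hfg : ∀ t ∈ Set.Icc a b, f t = f a + ∫ u in a..t, g u) :
    ∀ᵐ t ∂(volume.restrict (Set.Icc a b)), g t = deriv f t := by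
  have hg' : IntervalIntegrable g volume a b := by
    rwa [intervalIntegrable_iff_integrableOn_Icc_of_le hab]
  rw [ae_restrict_iff' measurableSet_Icc]
  have ha : ∀ᵐ t : ℝ, t ≠ a := by simp [ae_iff, measure_singleton]
  have hb : ∀ᵐ t : ℝ, t ≠ b := by simp [ae_iff, measure_singleton]
  filter_upwards [hg'.ae_hasDerivAt_integral, ha, hb] with t ht hta htb htI
  rw [Set.uIcc_of_le hab] at ht
  have h1 := (ht htI a (Set.left_mem_Icc.2 hab)).const_add (f a)
  refine (HasDerivAt.deriv (h1.congr_of_eventuallyEq ?_)).symm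
  filter_upwards [Icc_mem_nhds (lt_of_le_of_ne htI.1 hta.symm) (lt_of_le_of_ne htI.2 htb)]
    with s hs using hfg s hs

/-- Lower bound of the action of a solution of Newton's equation in terms of its initial
velocity. -/
theorem le_action_of_newton {n : ℕ} {a b : ℝ} (hab : a < b) {m : ℝ} {V : Eu n → ℝ}
    (hV : Differentiable ℝ V) {B : ℝ} (hB : ∀ x, |V x| ≤ B)
    {L : Eu n → Eu n → ℝ} (hL : ∀ x v : Eu n, L x v = m / 2 * ‖v‖ ^ 2 - V x)
    {f : ℝ → Eu n} (hf : ContDiff ℝ 2 f)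
    (hEL : ∀ t ∈ Set.Icc a b, m • deriv (deriv f) t = -gradient V (f t)) :
    (((b - a) * (m / 2 * ‖deriv f a‖ ^ 2 - 3 * B) : ℝ) : EReal) ≤
      action L a b (toPath a b f hf.continuous) := by
  unfold action
  split_ifs with h hint
  · rw [EReal.coe_le_coe_iff]
    have hae : ∀ᵐ t ∂(volume.restrict (Set.Icc a b)), h.choose t = deriv f t :=
      ae_eq_deriv_of_forall_eq_add_integral hab.le h.choose_spec.1 fun t ht =>
        h.choose_spec.2 ⟨a, Set.left_mem_Icc.2 hab.le⟩ ⟨t, ht⟩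
    calc (b - a) * (m / 2 * ‖deriv f a‖ ^ 2 - 3 * B)
        = ∫ _ in Set.Icc a b, (m / 2 * ‖deriv f a‖ ^ 2 - 3 * B) := by
          simp [hab.le]
      _ ≤ _ := by
          refine integral_mono_ae (integrable_const _) hint ?_
          filter_upwards [hae, ae_restrict_mem measurableSet_Icc] with t ht htI
          have hp : pev (toPath a b f hf.continuous) t = f t := by
            rw [pev, dif_pos htI]; rfl
          have := newton_energy_eq hV hf hEL htI
          have h1 := abs_le.1 (hB (f t))
          have h2 := abs_le.1 (hB (f a))
          simp only [ht, hp, hL]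
          linarith
  · exact le_top
  · exact le_top

/-- Uniqueness of solutions of Newton's equation with given initial position and velocity. -/
theorem newton_eqOn {n : ℕ} {a b m : ℝ} (hm : m ≠ 0) {V : Eu n → ℝ} (hV : ContDiff ℝ 2 V)
    {f g : ℝ → Eu n} (hf : ContDiff ℝ 2 f) (hg : ContDiff ℝ 2 g)
    (hfEL : ∀ t ∈ Set.Icc a b, m • deriv (deriv f) t = -gradient V (f t))
    (hgEL : ∀ t ∈ Set.Icc a b, m • deriv (deriv g) t = -gradient V (g t))
    (h0 : f a = g a) (h1 : deriv f a = deriv g a) :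
    Set.EqOn f g (Set.Icc a b) := by
  have hgrad : ContDiff ℝ 1 (gradient V) :=
    (InnerProductSpace.toDual ℝ (Eu n)).symm.contDiff.comp
      (hV.fderiv_right (m := 1) (by norm_num))
  let W : Eu n × Eu n → Eu n × Eu n := fun p => (p.2, -(m⁻¹ • gradient V p.1))
  have hW : ContDiff ℝ 1 W :=
    contDiff_snd.prodMk ((hgrad.comp contDiff_fst).const_smul m⁻¹).neg
  have hcont : ∀ {h : ℝ → Eu n}, ContDiff ℝ 2 h → Continuous fun t => (h t, deriv h t) :=
    fun hh => hh.continuous.prodMk (hh.continuous_deriv (by norm_num))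
  have hderiv : ∀ {h : ℝ → Eu n}, ContDiff ℝ 2 h →
      (∀ t ∈ Set.Icc a b, m • deriv (deriv h) t = -gradient V (h t)) →
      ∀ t ∈ Set.Ico a b,
        HasDerivWithinAt (fun t => (h t, deriv h t)) (W (h t, deriv h t)) (Set.Ici t) t := by
    intro h hh hEL t ht
    have e : -(m⁻¹ • gradient V (h t)) = deriv (deriv h) t := by
      rw [← smul_neg, ← hEL t (Set.Ico_subset_Icc_self ht), smul_smul, inv_mul_cancel₀ hm,
        one_smul]
    have hd := (hh.differentiable (by norm_num) t).hasDerivAt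
    have hdd := (hh.differentiable_deriv_two t).hasDerivAt
    simp only [W, e]
    exact (hd.prodMk hdd).hasDerivWithinAt
  obtain ⟨R, hR⟩ := ((isCompact_Icc (a := a) (b := b)).image (hcont hf)).union
    ((isCompact_Icc (a := a) (b := b)).image (hcont hg)) |>.isBounded.subset_closedBall 0
  obtain ⟨K, hK⟩ := hW.contDiffOn.exists_lipschitzOnWith (by norm_num)
    (convex_closedBall (0 : Eu n × Eu n) R) (isCompact_closedBall _ _)
  have key := ODE_solution_unique_of_mem_Icc_right (v := fun _ => W)
    (s := fun _ => Metric.closedBall 0 R) (fun _ _ => hK)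
    (hcont hf).continuousOn (hderiv hf hfEL)
    (fun t ht => hR (Or.inl ⟨t, Set.Ico_subset_Icc_self ht, rfl⟩))
    (hcont hg).continuousOn (hderiv hg hgEL)
    (fun t ht => hR (Or.inr ⟨t, Set.Ico_subset_Icc_self ht, rfl⟩))
    (by simp only [h0, h1])
  exact fun t ht => congrArg Prod.fst (key ht)

/-- A solution of Newton's equation is the image of its initial data under the flow map. -/
theorem IsNewtonFlow.apply_eq_toPath {n : ℕ} {a b m : ℝ} (hm : m ≠ 0) {V : Eu n → ℝ}
    (hV : ContDiff ℝ 2 V) {Φ : Eu n × Eu n → CPath a b n} (hΦ : IsNewtonFlow m V a b Φ)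
    {f : ℝ → Eu n} (hf : ContDiff ℝ 2 f)
    (hEL : ∀ t ∈ Set.Icc a b, m • deriv (deriv f) t = -gradient V (f t)) :
    Φ (f a, deriv f a) = toPath a b f hf.continuous := by
  obtain ⟨g, hg, hΦg, hga, hga', hgEL⟩ := hΦ.2 (f a) (deriv f a)
  ext1 t
  exact (hΦg t).trans (newton_eqOn hm hV hg hf hgEL hEL hga hga' t.2)

/-- An empirical measure of at least one point is a probability measure. -/
theorem isProbabilityMeasure_emp {X : Type*} [MeasurableSpace X] {N : ℕ} (hN : N ≠ 0)
    (x : Fin N → X) : IsProbabilityMeasure (emp N x) := by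
  constructor
  simp [emp, ENNReal.inv_mul_cancel, hN]

/-- The pushforward of an empirical measure is the empirical measure of the images. -/
theorem map_emp {X Y : Type*} [MeasurableSpace X] [MeasurableSpace Y] {g : X → Y}
    (hg : Measurable g) (N : ℕ) (x : Fin N → X) :
    Measure.map g (emp N x) = emp N (fun i => g (x i)) := by
  ext s hs
  simp [emp, Measure.map_apply hg hs, Measure.dirac_apply', hg hs, hs, Set.indicator]
  rfl

/-- An empirical measure of points of a measurable set gives full mass to this set. -/
theorem emp_eq_one {X : Type*} [MeasurableSpace X] {N : ℕ} (hN : N ≠ 0) {x : Fin N → X}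
    {s : Set X} (hs : MeasurableSet s) (hx : ∀ i, x i ∈ s) : emp N x s = 1 := by
  simp [emp, Measure.dirac_apply', hs, hx, ENNReal.inv_mul_cancel, hN]

/-- Markov's inequality for empirical measures. -/
theorem emp_le_of_sum_le {X : Type*} [MeasurableSpace X] {N : ℕ} (hN : N ≠ 0) {x : Fin N → X}
    {s : Set X} (hs : MeasurableSet s) {g : X → ℝ} (hg0 : ∀ y, 0 ≤ g y) {r M : ℝ} (hr : 0 < r)
    (hg : ∀ i, x i ∈ s → r ≤ g (x i)) (hM : ∑ i, g (x i) ≤ N * M) :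
    emp N x s ≤ ENNReal.ofReal (M / r) := by
  have hN' : (0 : ℝ) < N := by exact_mod_cast Nat.pos_of_ne_zero hN
  have h1 : ∀ i, Measure.dirac (x i) s ≤ ENNReal.ofReal (g (x i) / r) := by
    intro i
    rw [Measure.dirac_apply' _ hs]
    by_cases h : x i ∈ s
    · rw [Set.indicator_of_mem h, Pi.one_apply, ENNReal.one_le_ofReal, one_le_div hr]
      exact hg i h
    · simp [h]
  have h2 : ∑ i, Measure.dirac (x i) s ≤ N * ENNReal.ofReal (M / r) := by
    refine (Finset.sum_le_sum fun i _ => h1 i).trans ?_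
    rw [← ENNReal.ofReal_sum_of_nonneg fun i _ => div_nonneg (hg0 _) hr.le, ← Finset.sum_div,
      ← ENNReal.ofReal_natCast, ← ENNReal.ofReal_mul hN'.le, ← mul_div_assoc]
    exact ENNReal.ofReal_le_ofReal (by gcongr)
  simp only [emp, Measure.smul_apply, Measure.coe_finsetSum, Finset.sum_apply, smul_eq_mul]
  calc (N : ℝ≥0∞)⁻¹ * ∑ i, Measure.dirac (x i) s
      ≤ (N : ℝ≥0∞)⁻¹ * (N * ENNReal.ofReal (M / r)) := by gcongr
    _ = ENNReal.ofReal (M / r) := by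
      rw [← mul_assoc, ENNReal.inv_mul_cancel (by simpa using hN) (by simp), one_mul]

/-- Empirical measures on `ℝⁿ × ℝⁿ` whose first marginals live on a fixed compact set and whose
second marginals have uniformly bounded second moments have a weakly convergent subsequence. -/
theorem exists_subseq_tendsto_emp {n : ℕ} {Ka : Set (Eu n)} (hKa : IsCompact Ka)
    (x : (N : ℕ) → Fin N → Eu n × Eu n) (hx : ∀ N i, (x N i).1 ∈ Ka) {M : ℝ}
    (hM : ∀ N, ∑ i, ‖(x N i).2‖ ^ 2 ≤ N * M) :
    ∃ φ : ℕ → ℕ, StrictMono φ ∧ (∀ k, φ k ≠ 0) ∧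
      ∃ (P : ℕ → ProbabilityMeasure (Eu n × Eu n)) (η : ProbabilityMeasure (Eu n × Eu n)),
        (∀ k, (P k : Measure (Eu n × Eu n)) = emp (φ k) (x (φ k))) ∧
        Tendsto P atTop (𝓝 η) := by
  let P : ℕ → ProbabilityMeasure (Eu n × Eu n) := fun k =>
    ⟨emp (k + 1) (x (k + 1)), isProbabilityMeasure_emp k.succ_ne_zero _⟩
  have htight : IsTightMeasureSet {((μ : ProbabilityMeasure (Eu n × Eu n)) :
      Measure (Eu n × Eu n)) | μ ∈ Set.range P} := by
    rw [isTightMeasureSet_iff_exists_isCompact_measure_compl_le]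
    intro ε hε
    have hlim : Tendsto (fun r : ℝ => ENNReal.ofReal (M / r ^ 2)) atTop (𝓝 0) := by
      rw [← ENNReal.ofReal_zero]
      exact ENNReal.tendsto_ofReal (tendsto_const_nhds.div_atTop (tendsto_pow_atTop two_ne_zero))
    obtain ⟨R, hRε, hR⟩ := ((hlim.eventually_le_const hε).and (eventually_gt_atTop 0)).exists
    refine ⟨Ka ×ˢ Metric.closedBall 0 R, hKa.prod (isCompact_closedBall _ _), ?_⟩
    rintro _ ⟨_, ⟨k, rfl⟩, rfl⟩
    refine le_trans ?_ hRε
    refine emp_le_of_sum_le (g := fun y => ‖y.2‖ ^ 2) k.succ_ne_zero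
      (hKa.prod (isCompact_closedBall _ _)).measurableSet.compl
      (fun y => by positivity) (by positivity) (fun i hi => ?_) (hM _)
    have : R < ‖(x (k + 1) i).2‖ := by
      by_contra! h
      exact hi ⟨hx _ i, by simpa using h⟩
    gcongr
  obtain ⟨η, -, ψ, hψ, hlim⟩ := (isCompact_closure_of_isTightMeasureSet htight).isSeqCompact
    (fun k => subset_closure (Set.mem_range_self k))
  exact ⟨fun k => ψ k + 1, fun i j hij => Nat.succ_lt_succ (hψ hij), fun k => Nat.succ_ne_zero _,
    P ∘ ψ, η, fun k => rfl, hlim⟩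

/-- **Convergence of stationary points (Theorem 3.10).**
If `γ_1^{(N)},…,γ_N^{(N)}` are `C²` solutions of the Newton equation `mγ'' = −∇V(γ)`
starting in `K_a`, ending in `K_b` and with average action at most `C`, then the empirical
measures `π^{(N)} = (1/N)∑ δ_{γ_i^{(N)}}` admit a weakly convergent subsequence whose limit
`π` is concentrated on the extremals from `K_a` to `K_b` and is the pushforward of some
probability measure `η` on `ℝⁿ × ℝⁿ` under the Euler–Lagrange flow map `Φ`. -/
theorem convergence_of_stationary_points
    {n : ℕ} (hn : 1 ≤ n) {a b : ℝ} (hab : a < b)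
    (m : ℝ) (hm : 0 < m) (V : Eu n → ℝ)
    (hV1 : ContDiff ℝ (⊤ : ℕ∞) V) (hV2 : ∃ CV : ℝ, ∀ x, |V x| ≤ CV)
    (L : Eu n → Eu n → ℝ) (hL : ∀ x v : Eu n, L x v = m / 2 * ‖v‖ ^ 2 - V x)
    (Φ : Eu n × Eu n → CPath a b n) (hΦ : IsNewtonFlow m V a b Φ)
    (Ka Kb : Set (Eu n)) (hKa : IsCompact Ka) (hKb : IsCompact Kb)
    (C : ℝ) (hC : 0 < C)
    (γ : (N : ℕ) → Fin N → ℝ → Eu n)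
    (hγC2 : ∀ N i, ContDiff ℝ 2 (γ N i))
    (hEL : ∀ N i, ∀ t ∈ Set.Icc a b,
      m • deriv (deriv (γ N i)) t = -gradient V (γ N i t))
    (hstart : ∀ N i, γ N i a ∈ Ka) (hend : ∀ N i, γ N i b ∈ Kb)
    (hact : ∀ N : ℕ,
      (∑ i : Fin N, action L a b (toPath a b (γ N i) (hγC2 N i).continuous)) ≤
        ((N : ℝ) * C : ℝ)) :
    ∃ φ : ℕ → ℕ, StrictMono φ ∧ ∃ π : Measure (CPath a b n), IsProbabilityMeasure π ∧
      WeakLim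
        (fun k => emp (φ k) (fun i => toPath a b (γ (φ k) i) (hγC2 (φ k) i).continuous))
        π ∧
      π (NewtonSet m V a b Ka Kb) = 1 ∧
      ∃ η : Measure (Eu n × Eu n), IsProbabilityMeasure η ∧ π = Measure.map Φ η := by
  obtain ⟨B, hB⟩ := hV2
  have hV : ContDiff ℝ 2 V := hV1.of_le (WithTop.coe_le_coe.2 le_top)
  have hVd : Differentiable ℝ V := hV.differentiable (by norm_num)
  have hba : 0 < b - a := sub_pos.2 hab
  let x : (N : ℕ) → Fin N → Eu n × Eu n := fun N i => (γ N i a, deriv (γ N i) a)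
  have hΦx : ∀ N i, Φ (x N i) = toPath a b (γ N i) (hγC2 N i).continuous := fun N i =>
    hΦ.apply_eq_toPath hm.ne' hV (hγC2 N i) (hEL N i)
  have hM : ∀ N, ∑ i, ‖(x N i).2‖ ^ 2 ≤ N * ((C / (b - a) + 3 * B) / (m / 2)) := by
    intro N
    have h := (Finset.sum_le_sum fun i (_ : i ∈ Finset.univ) =>
      le_action_of_newton hab hVd hB hL (hγC2 N i) (hEL N i)).trans (hact N)
    have hcoe : ∀ c : Fin N → ℝ, ((∑ i, c i : ℝ) : EReal) = ∑ i, (c i : EReal) := fun c =>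
      map_sum (⟨⟨Real.toEReal, EReal.coe_zero⟩, EReal.coe_add⟩ : ℝ →+ EReal) c _
    rw [← hcoe, EReal.coe_le_coe_iff, ← Finset.mul_sum, Finset.sum_sub_distrib,
      ← Finset.mul_sum] at h
    simp only [Finset.sum_const, Finset.card_univ, Fintype.card_fin, nsmul_eq_mul] at h
    rw [mul_comm (b - a), ← le_div_iff₀ hba] at h
    rw [← mul_div_assoc, le_div_iff₀ (by positivity), mul_add, ← mul_div_assoc (N : ℝ) C,
      mul_comm _ (m / 2)]
    exact sub_le_iff_le_add.1 h
  obtain ⟨φ, hφ, hφ0, P, η, hP, hlim⟩ := exists_subseq_tendsto_emp hKa x hstart hM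
  have hemp : ∀ k, Measure.map Φ (P k) =
      emp (φ k) (fun i => toPath a b (γ (φ k) i) (hγC2 (φ k) i).continuous) := by
    intro k
    rw [hP k, map_emp hΦ.1.measurable]
    simp only [hΦx]
  have hprob : IsProbabilityMeasure (Measure.map Φ (η : Measure (Eu n × Eu n))) :=
    Measure.isProbabilityMeasure_map hΦ.1.measurable.aemeasurable
  refine ⟨φ, hφ, Measure.map Φ η, hprob, fun ψ => ?_, ?_, η, inferInstance, rfl⟩
  · have h := ProbabilityMeasure.tendsto_iff_forall_integral_tendsto.1 hlim
      (ψ.compContinuous ⟨Φ, hΦ.1⟩)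
    simp only [← hemp]
    have e : ∀ μ : Measure (Eu n × Eu n), ∫ y, ψ y ∂(Measure.map Φ μ) = ∫ p, ψ (Φ p) ∂μ :=
      fun μ => integral_map_of_stronglyMeasurable hΦ.1.measurable
        ψ.continuous.stronglyMeasurable
    simp only [e]
    exact h
  · let tb : Set.Icc a b := ⟨b, Set.right_mem_Icc.2 hab.le⟩
    let F : Set (Eu n × Eu n) := {p | p.1 ∈ Ka ∧ Φ p tb ∈ Kb}
    have hF : IsClosed F := (hKa.isClosed.preimage continuous_fst).inter
      (hKb.isClosed.preimage ((continuous_eval_const tb).comp hΦ.1))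
    have hFsub : Φ '' F ⊆ NewtonSet m V a b Ka Kb := by
      rintro _ ⟨⟨y, v⟩, ⟨hy, hyb⟩, rfl⟩
      obtain ⟨f, hf, hΦf, hfa, -, hfEL⟩ := hΦ.2 y v
      exact ⟨f, hf, hΦf, hfEL, hfa ▸ hy, hΦf tb ▸ hyb⟩
    have hPF : ∀ k, (P k : Measure (Eu n × Eu n)) F = 1 := fun k => by
      rw [hP k]
      refine emp_eq_one (hφ0 k) hF.measurableSet fun i => ⟨hstart _ i, ?_⟩
      rw [hΦx]
      exact hend _ i
    have hηF : 1 ≤ (η : Measure (Eu n × Eu n)) F := by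
      have := ProbabilityMeasure.limsup_measure_closed_le_of_tendsto hlim hF
      simpa [hPF] using this
    refine le_antisymm prob_le_one ?_
    calc (1 : ℝ≥0∞) ≤ (η : Measure (Eu n × Eu n)) F := hηF
      _ ≤ Measure.map Φ η (Φ '' F) :=
          Measure.le_map_apply_image hΦ.1.measurable.aemeasurable F
      _ ≤ _ := measure_mono hFsub
end
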